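/- For the MDP model E2 with initial state x0 = b_1 = 1/2 and the set Λ = {ψ^n : n ≥ 3} ∪ {ψ}, the set of marginals on Y of the occupation measures over Λ, D^Λ_{x0}|_Y = {η^{ψ^n}_{1/2}|_Y : n ≥ 3} ∪ {η^{ψ}_{1/2}|_Y}, is compact in M(Y) with respect to the w-topology but is not compact with respect to the s-topology. -/

import Mathlib

open MeasureTheory ProbabilityTheory Filter Topology
open scoped ENNReal

noncomputable section

/-! ### General MDP framework

The state space of an absorbing-type MDP model is `X = Y ⊕ Unit`, where `Sum.inr ()` plays
the role of the isolated cemetery point `Δ` and `Y` is embedded via `Sum.inl`.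

A history up to stage `n` is `h_n = (x_0, a_1, x_1, …, a_n, x_n)`, which we encode as the
list of pairs `(x_k, a_{k+1})`, `k < n`, together with the last state `x_n`. -/

/-- The space `H_n` of histories up to stage `n`. -/
abbrev Hist (X A : Type*) (n : ℕ) : Type _ := (Fin n → X × A) × X

/-- A strategy: for every `n`, a stochastic (Markov) kernel on `A` given `H_n`,
prescribing the law of the action `a_{n+1}` given the history `h_n`. -/
def Strategy (X A : Type*) [MeasurableSpace X] [MeasurableSpace A] : Type _ :=
  {π : (n : ℕ) → Kernel (Hist X A n) A // ∀ n, IsMarkovKernel (π n)}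

variable {X A Y : Type*} [MeasurableSpace X] [MeasurableSpace A] [MeasurableSpace Y]

/-- The finite-dimensional distributions of the strategic measure `P^π_{x0}`:
`histLaw p π x0 n` is the joint law of `(X_0, A_1, …, A_n, X_n)` under `P^π_{x0}`,
built by the Ionescu-Tulcea recursion. -/
def histLaw (p : Kernel (X × A) X) (π : Strategy X A) (x0 : X) :
    (n : ℕ) → Measure (Hist X A n)
  | 0 => Measure.dirac (fun i => i.elim0, x0)
  | n + 1 =>
      (histLaw p π x0 n).bind fun h =>
        ((π.1 n) h).bind fun a =>
          (p (h.2, a)).map fun x' => (Fin.snoc h.1 (h.2, a), x')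

/-- The law of the pair `(X_n, A_{n+1})` under the strategic measure `P^π_{x0}`. -/
def pairLaw (p : Kernel (X × A) X) (π : Strategy X A) (x0 : X) (n : ℕ) :
    Measure (X × A) :=
  (histLaw p π x0 n).bind fun h => ((π.1 n) h).map fun a => (h.2, a)

/-- The occupation measure `η^π_{x0}` on `Y × A`:
`η^π_{x0}(dx × da) = Σ_n P^π_{x0}(X_n ∈ dx ∩ Y, A_{n+1} ∈ da)`. -/
def occupation (p : Kernel ((Y ⊕ Unit) × A) (Y ⊕ Unit)) (π : Strategy (Y ⊕ Unit) A)
    (x0 : Y ⊕ Unit) : Measure (Y × A) :=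
  Measure.sum fun n => (pairLaw p π x0 n).comap fun ya : Y × A => (Sum.inl ya.1, ya.2)

/-- `P^π_{x0}(X_t ∈ Y)`.  Since the cemetery `Δ` is absorbing, this equals the tail
probability `P^π_{x0}(τ > t)` of the hitting time `τ` of `Δ`. -/
def survive (p : Kernel ((Y ⊕ Unit) × A) (Y ⊕ Unit)) (π : Strategy (Y ⊕ Unit) A)
    (x0 : Y ⊕ Unit) (t : ℕ) : ℝ≥0∞ :=
  pairLaw p π x0 t {z | ∃ y : Y, z.1 = Sum.inl y}

/-- The model is absorbing with initial state `x0`: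
`E^π_{x0}[τ] = Σ_t P^π_{x0}(τ > t) < ∞` for every strategy `π`. -/
def IsAbsorbing (p : Kernel ((Y ⊕ Unit) × A) (Y ⊕ Unit)) (x0 : Y ⊕ Unit) : Prop :=
  ∀ π : Strategy (Y ⊕ Unit) A, ∑' t : ℕ, survive p π x0 t < ⊤

/-- The model is `Λ`-uniformly absorbing with initial state `x0`:
`sup_{π ∈ Λ} E^π_{x0}[Σ_{t=n}^∞ 1{τ > t}] = sup_{π ∈ Λ} Σ_{t ≥ n} P^π_{x0}(τ > t) → 0`. -/
def IsUnifAbsorbing (p : Kernel ((Y ⊕ Unit) × A) (Y ⊕ Unit))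
    (Λ : Set (Strategy (Y ⊕ Unit) A)) (x0 : Y ⊕ Unit) : Prop :=
  Tendsto (fun n : ℕ => ⨆ π ∈ Λ, ∑' t : ℕ, survive p π x0 (n + t)) atTop (𝓝 0)

/-- The set `D^Λ_{x0} ⊆ M(Y × A)` of occupation measures of strategies in `Λ`. -/
def OccSet (p : Kernel ((Y ⊕ Unit) × A) (Y ⊕ Unit)) (Λ : Set (Strategy (Y ⊕ Unit) A))
    (x0 : Y ⊕ Unit) : Set (FiniteMeasure (Y × A)) :=
  {η | ∃ π ∈ Λ, (η : Measure (Y × A)) = occupation p π x0}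

/-- Condition (S): the action space is compact and `a ↦ ∫ g dp(·|x,a)` is continuous for
every bounded measurable `g` and every state `x`. -/
def ConditionS [TopologicalSpace A] (p : Kernel (X × A) X) : Prop :=
  CompactSpace A ∧
    ∀ g : X → ℝ, Measurable g → (∃ C, ∀ x, |g x| ≤ C) →
      ∀ x : X, Continuous fun a : A => ∫ y, g y ∂(p (x, a))

/-- Condition (W): the action space is compact and `(x,a) ↦ ∫ g dp(·|x,a)` is continuous for
every bounded continuous `g`. -/
def ConditionW [TopologicalSpace X] [TopologicalSpace A] (p : Kernel (X × A) X) : Prop :=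
  CompactSpace A ∧
    ∀ g : X → ℝ, Continuous g → (∃ C, ∀ x, |g x| ≤ C) →
      Continuous fun xa : X × A => ∫ y, g y ∂(p xa)

/-- The w-topology on `M(Ω)`: the coarsest topology making `η ↦ ∫ g dη` continuous for
every bounded continuous `g : Ω → ℝ`. -/
def wTop (Ω : Type*) [TopologicalSpace Ω] [MeasurableSpace Ω] :
    TopologicalSpace (FiniteMeasure Ω) :=
  ⨅ (g : Ω → ℝ) (_ : Continuous g) (_ : ∃ C, ∀ z, |g z| ≤ C),
    TopologicalSpace.induced (fun η : FiniteMeasure Ω => ∫ z, g z ∂(η : Measure Ω))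
      inferInstance

/-- The ws-topology on `M(Y × A)`: the coarsest topology making `η ↦ ∫ g dη` continuous for
every bounded Caratheodory function `g : Y × A → ℝ`. -/
def wsTop (Y A : Type*) [MeasurableSpace Y] [TopologicalSpace A] [MeasurableSpace A] :
    TopologicalSpace (FiniteMeasure (Y × A)) :=
  ⨅ (g : Y × A → ℝ) (_ : Measurable g) (_ : ∃ C, ∀ z, |g z| ≤ C)
    (_ : ∀ y : Y, Continuous fun a : A => g (y, a)),
    TopologicalSpace.induced (fun η : FiniteMeasure (Y × A) => ∫ z, g z ∂(η : Measure (Y × A)))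
      inferInstance

/-- The s-topology on `M(Y)`: the coarsest topology making `η ↦ ∫ f dη` continuous for
every bounded measurable `f : Y → ℝ`. -/
def sTop (Y : Type*) [MeasurableSpace Y] : TopologicalSpace (FiniteMeasure Y) :=
  ⨅ (f : Y → ℝ) (_ : Measurable f) (_ : ∃ C, ∀ z, |f z| ≤ C),
    TopologicalSpace.induced (fun η : FiniteMeasure Y => ∫ z, f z ∂(η : Measure Y))
      inferInstance



/-! ### The MDP model E2 (Example 2 of the paper):
`Y = {b_n : n ≥ 1} ∪ {1} ⊆ ℝ` with `b_n = Σ_{i=1}^n 2^{-i} = 1 - 2^{-n}` (relative Euclidean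
topology), `A = {1,2,3}` discrete (here `Fin 3`, with `0 ↔ 1`, `1 ↔ 2`, `2 ↔ 3`). -/

/-- `b n = 1 - 2^{-n}`; the points of `Y` are `b n` for `n ≥ 1`, together with `1`. -/
def b2 : ℕ → ℝ := fun n => 1 - (1/2) ^ n

/-- The set `Y = {b_n : n ≥ 1} ∪ {1} ⊆ ℝ`. -/
def SY2 : Set ℝ := {x : ℝ | ∃ k : ℕ, x = b2 (k + 1)} ∪ {1}

/-- The space `Y` of the model E2, with the relative Euclidean topology. -/
abbrev Y2 : Type := ↥SY2

/-- The point `b_{k+1} ∈ Y` (so `bY 0 = b_1 = 1/2`). -/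
def bY (k : ℕ) : Y2 := ⟨b2 (k + 1), Or.inl ⟨k, rfl⟩⟩

/-- The point `1 ∈ Y`. -/
def oneY : Y2 := ⟨1, Or.inr rfl⟩

/-- The action space `A = {1,2,3}` of the model E2 (as `Fin 3`: `0 ↔ 1`, `1 ↔ 2`, `2 ↔ 3`). -/
abbrev A2 : Type := Fin 3

/-- The state space `X = Y ∪ {Δ}` of the model E2. -/
abbrev X2 : Type := Y2 ⊕ Unit

/-- The initial state `x₀ = b_1 = 1/2`. -/
def x02 : X2 := Sum.inl (bY 0)

/-- `π` is the deterministic stationary strategy given by the map `ψ`: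
at every stage the action is `ψ(x)` where `x` is the current state. -/
def IsStationaryWith {X A : Type*} [MeasurableSpace X] [MeasurableSpace A]
    (π : Strategy X A) (ψ : X → A) : Prop :=
  ∀ n, ∀ h : Hist X A n, (π.1 n) h = Measure.dirac (ψ h.2)

open scoped Classical in
/-- The map of the deterministic stationary strategy `ψ^n` (paper indexing, `n ≥ 3`):
action `2` on `{b_1, …, b_n}`, action `1` on `{b_m : m ≥ n+1}`, action `3` on `{1, Δ}`. -/
def psiN (n : ℕ) : X2 → A2 := fun x =>
  match x with
  | Sum.inr _ => 2
  | Sum.inl y =>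
      if (y : ℝ) = 1 then 2 else if ∃ k, k < n ∧ (y : ℝ) = b2 (k + 1) then 1 else 0

/-- The map of the deterministic stationary strategy `ψ ≡ 3`. -/
def psiInf : X2 → A2 := fun _ => 2

/-- `Λ = {ψ^n : n ≥ 3} ∪ {ψ}`. -/
def Lambda2 : Set (Strategy X2 A2) :=
  {π | ∃ n, 3 ≤ n ∧ IsStationaryWith π (psiN n)} ∪ {π | IsStationaryWith π psiInf}

section E2Kernel

variable (p : Kernel (X2 × A2) X2)

/-- The transition kernel of the model E2 (the action `a = 1` at `b_1` leads to `Δ`;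
at `b_n`, `n ≥ 2`, it stays with probability `1 - 2^{2-n}` and moves to `Δ` with probability
`2^{2-n}`; `a = 2` moves to `b_{n+1}` or `Δ` with probability `1/2` each; `a = 3` moves to
`b_{n+1}` with probability `1/2` and to `1` or `Δ` with probability `1/4` each; `1` and `Δ`
lead to `Δ`).  In the indexing below, `bY k` is the paper's `b_{k+1}`, and for `n = k+1 ≥ 2`
one has `2^{2-n} = (1/2)^{k-1}`. -/
def IsE2Kernel : Prop :=
  (∀ a : A2, p ((Sum.inr () : X2), a) {(Sum.inr () : X2)} = 1) ∧
  (∀ a : A2, p (Sum.inl oneY, a) {(Sum.inr () : X2)} = 1) ∧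
  (p (Sum.inl (bY 0), (0 : A2)) {(Sum.inr () : X2)} = 1) ∧
  (∀ k : ℕ, 1 ≤ k →
    p (Sum.inl (bY k), (0 : A2)) {(Sum.inl (bY k) : X2)} = 1 - (1/2 : ℝ≥0∞) ^ (k - 1) ∧
    p (Sum.inl (bY k), (0 : A2)) {(Sum.inr () : X2)} = (1/2 : ℝ≥0∞) ^ (k - 1)) ∧
  (∀ k : ℕ,
    p (Sum.inl (bY k), (1 : A2)) {(Sum.inr () : X2)} = 1/2 ∧
    p (Sum.inl (bY k), (1 : A2)) {(Sum.inl (bY (k + 1)) : X2)} = 1/2) ∧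
  (∀ k : ℕ,
    p (Sum.inl (bY k), (2 : A2)) {(Sum.inr () : X2)} = 1/4 ∧
    p (Sum.inl (bY k), (2 : A2)) {(Sum.inl oneY : X2)} = 1/4 ∧
    p (Sum.inl (bY k), (2 : A2)) {(Sum.inl (bY (k + 1)) : X2)} = 1/2)

end E2Kernel

instance : Countable Y2 := by
  have : SY2.Countable := by
    refine Set.Countable.union ?_ (Set.countable_singleton 1)
    exact (Set.countable_range fun k => b2 (k + 1)).mono (by rintro x ⟨k, rfl⟩; exact ⟨k, rfl⟩)
  exact this.to_subtype

instance instMeasurableSingletonClassSum {α β : Type*} [MeasurableSpace α] [MeasurableSpace β]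
    [MeasurableSingletonClass α] [MeasurableSingletonClass β] :
    MeasurableSingletonClass (α ⊕ β) where
  measurableSet_singleton := by
    rintro (a | b)
    · simpa using (measurableSet_singleton a).inl_image (β := β)
    · simpa using (measurableSet_singleton b).inr_image (α := α)

lemma measurableEmbedding_inl {α β : Type*} [MeasurableSpace α] [MeasurableSpace β] :
    MeasurableEmbedding (Sum.inl : α → α ⊕ β) :=
  ⟨Sum.inl_injective, measurable_inl, fun _ => MeasurableSet.inl_image⟩

/-- The law of `X_n` under the strategic measure `P^π_{x0}`. -/
def stateLaw (p : Kernel (X × A) X) (π : Strategy X A) (x0 : X) (n : ℕ) : Measure X :=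
  (histLaw p π x0 n).map Prod.snd

lemma stateLaw_zero (p : Kernel (X × A) X) (π : Strategy X A) (x0 : X) :
    stateLaw p π x0 0 = Measure.dirac x0 := by
  rw [stateLaw, histLaw, Measure.map_dirac' measurable_snd]

section Stationary

variable [Countable X] [MeasurableSingletonClass X] [Countable A] [MeasurableSingletonClass A]
  {π : Strategy X A} {ψ : X → A}

/-- The deterministic stationary strategy given by `ψ`. -/
def stationaryStrategy (ψ : X → A) : Strategy X A :=
  ⟨fun n => Kernel.deterministic (fun h : Hist X A n => ψ h.2) (Measurable.of_discrete),
    fun _ => inferInstance⟩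

lemma isStationaryWith_stationaryStrategy (ψ : X → A) :
    IsStationaryWith (stationaryStrategy ψ) ψ :=
  fun _ _ => Kernel.deterministic_apply .of_discrete _

lemma pairLaw_eq_map (p : Kernel (X × A) X) (hπ : IsStationaryWith π ψ) (x0 : X) (n : ℕ) :
    pairLaw p π x0 n = (stateLaw p π x0 n).map fun x => (x, ψ x) := by
  rw [stateLaw, Measure.map_map .of_discrete .of_discrete, pairLaw,
    ← Measure.bind_dirac_eq_map _ .of_discrete]
  congr 1 with h : 1
  rw [hπ, Measure.map_dirac' .of_discrete]
  rfl

lemma stateLaw_succ (p : Kernel (X × A) X) (hπ : IsStationaryWith π ψ) (x0 : X) (n : ℕ) :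
    stateLaw p π x0 (n + 1) = (stateLaw p π x0 n).bind fun x => p (x, ψ x) := by
  ext s hs
  rw [stateLaw, Measure.map_apply measurable_snd hs, histLaw,
    Measure.bind_apply (measurable_snd hs) .of_discrete, Measure.bind_apply hs .of_discrete,
    stateLaw, lintegral_map .of_discrete .of_discrete]
  congr 1 with h
  rw [hπ, Measure.dirac_bind .of_discrete, Measure.map_apply .of_discrete (measurable_snd hs)]
  rfl

end Stationary

section Absorption

variable [Countable Y] [MeasurableSingletonClass Y] [Countable A] [MeasurableSingletonClass A]
  {π : Strategy (Y ⊕ Unit) A} {ψ : Y ⊕ Unit → A}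

lemma occupation_map_fst (p : Kernel ((Y ⊕ Unit) × A) (Y ⊕ Unit)) (hπ : IsStationaryWith π ψ)
    (x0 : Y ⊕ Unit) :
    (occupation p π x0).map Prod.fst =
      Measure.sum fun n => (stateLaw p π x0 n).comap Sum.inl := by
  rw [occupation, Measure.map_sum .of_discrete]
  congr 1 with n : 1
  ext s hs
  rw [Measure.map_apply measurable_fst hs, Measure.comap_apply _ _ _ _ .of_discrete,
    Measure.comap_apply _ Sum.inl_injective (fun _ _ => .of_discrete) _ hs, pairLaw_eq_map p hπ,
    Measure.map_apply .of_discrete .of_discrete]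
  · congr 1
    ext x
    simp only [Set.mem_preimage, Set.mem_image, Prod.mk.injEq, Prod.exists]
    constructor
    · rintro ⟨y, a, hy, rfl, -⟩
      exact ⟨y, hy, rfl⟩
    · rintro ⟨y, hy, rfl⟩
      exact ⟨y, _, hy, rfl, rfl⟩
  · rintro ⟨y, a⟩ ⟨y', a'⟩ h
    simpa using h
  · exact fun _ _ => .of_discrete

lemma comap_inl_bind (m : Measure (Y ⊕ Unit)) (κ : Y ⊕ Unit → Measure (Y ⊕ Unit))
    (hκ : (κ (Sum.inr ())).comap Sum.inl = (0 : Measure Y)) :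
    (m.bind κ).comap Sum.inl = (m.comap Sum.inl).bind fun y => (κ (Sum.inl y)).comap Sum.inl := by
  have hc (ρ : Measure (Y ⊕ Unit)) (s : Set Y) : ρ.comap Sum.inl s = ρ (Sum.inl '' s) :=
    Measure.comap_apply _ Sum.inl_injective (fun _ _ => .of_discrete) _ .of_discrete
  ext s hs
  rw [hc, Measure.bind_apply .of_discrete .of_discrete, Measure.bind_apply hs .of_discrete]
  simp_rw [hc]
  rw [← lintegral_map (μ := m.comap Sum.inl) (g := Sum.inl)
    (f := fun x => κ x (Sum.inl '' s)) .of_discrete .of_discrete, measurableEmbedding_inl.map_comap,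
    ← lintegral_indicator .of_discrete]
  congr 1 with x
  rcases x with y | ⟨⟩
  · simp
  · simp [← hc, hκ]

end Absorption

lemma comap_inl_singleton [MeasurableSingletonClass Y] (ρ : Measure (Y ⊕ Unit)) (y : Y) :
    ρ.comap Sum.inl {y} = ρ {Sum.inl y} := by
  rw [measurableEmbedding_inl.comap_apply, Set.image_singleton]

lemma comap_inl_eq_sum_of_sum_eq_one [Countable Y] [MeasurableSingletonClass Y]
    (ρ : Measure (Y ⊕ Unit)) [IsProbabilityMeasure ρ] (F : Finset Y)
    (h : ∑ y ∈ F, ρ {Sum.inl y} + ρ {Sum.inr ()} = 1) :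
    ρ.comap Sum.inl = ∑ y ∈ F, ρ {Sum.inl y} • Measure.dirac y := by
  classical
  set G : Finset (Y ⊕ Unit) := insert (Sum.inr ()) (F.image Sum.inl) with hG
  have hGρ : ρ (G : Set (Y ⊕ Unit))ᶜ = 0 := by
    rw [prob_compl_eq_zero_iff G.measurableSet, ← h, ← sum_measure_singleton, hG,
      Finset.sum_insert (by simp), Finset.sum_image (by simp), add_comm]
  refine Measure.ext_of_singleton fun y => ?_
  rw [comap_inl_singleton]
  by_cases hy : y ∈ F
  · simp [Measure.finsetSum_apply, Set.indicator_apply, hy]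
  · have : ρ {Sum.inl y} = 0 := measure_mono_null (by simpa [hG] using hy) hGρ
    simp [Measure.finsetSum_apply, Set.indicator_apply, hy, this]

lemma b2_succ_ne_one (k : ℕ) : b2 (k + 1) ≠ 1 := by
  simp [b2]

lemma b2_injective : Function.Injective b2 := by
  intro m n h
  have : ((1 / 2 : ℝ)) ^ m = (1 / 2) ^ n := by simpa [b2] using h
  exact pow_right_injective₀ (by norm_num) (by norm_num) this

lemma bY_injective : Function.Injective bY := fun m n h => by
  simpa using b2_injective (congrArg Subtype.val h)

lemma bY_ne_oneY (k : ℕ) : bY k ≠ oneY := fun h => b2_succ_ne_one k (congrArg Subtype.val h)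

lemma tendsto_bY : Tendsto bY atTop (𝓝 oneY) := by
  rw [tendsto_subtype_rng]
  have h := (tendsto_pow_atTop_nhds_zero_of_lt_one (r := (1 / 2 : ℝ)) (by norm_num)
    (by norm_num)).comp (tendsto_add_atTop_nat 1)
  simpa [bY, b2, oneY, Function.comp_def] using h.const_sub 1

lemma psiN_bY_of_lt {n k : ℕ} (h : k < n) : psiN n (Sum.inl (bY k)) = 1 := by
  have h1 : ((bY k : Y2) : ℝ) ≠ 1 := b2_succ_ne_one k
  have h2 : ∃ j, j < n ∧ ((bY k : Y2) : ℝ) = b2 (j + 1) := ⟨k, h, rfl⟩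
  simp [psiN, h1, h2]

lemma psiN_bY_self (n : ℕ) : psiN n (Sum.inl (bY n)) = 0 := by
  have h1 : ((bY n : Y2) : ℝ) ≠ 1 := b2_succ_ne_one n
  have h2 : ¬ ∃ j, j < n ∧ ((bY n : Y2) : ℝ) = b2 (j + 1) := by
    rintro ⟨j, hj, h⟩
    have := b2_injective (show b2 (n + 1) = b2 (j + 1) from h)
    omega
  simp [psiN, h1, h2]

lemma comap_stateLaw_zero (p : Kernel (X2 × A2) X2) (π : Strategy X2 A2) :
    (stateLaw p π x02 0).comap Sum.inl = Measure.dirac (bY 0) := by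
  refine Measure.ext_of_singleton fun y => ?_
  rw [comap_inl_singleton, stateLaw_zero, x02]
  simp [Set.indicator_apply]

section Transitions

variable {p : Kernel (X2 × A2) X2} [IsMarkovKernel p]

lemma IsE2Kernel.comap_cemetery (hp : IsE2Kernel p) (a : A2) :
    (p (Sum.inr (), a)).comap Sum.inl = (0 : Measure Y2) := by
  simpa using comap_inl_eq_sum_of_sum_eq_one (p (Sum.inr (), a)) ∅ (by simpa using hp.1 a)

lemma IsE2Kernel.comap_oneY (hp : IsE2Kernel p) (a : A2) :
    (p (Sum.inl oneY, a)).comap Sum.inl = (0 : Measure Y2) := by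
  simpa using comap_inl_eq_sum_of_sum_eq_one (p (Sum.inl oneY, a)) ∅ (by simpa using hp.2.1 a)

lemma IsE2Kernel.comap_stay (hp : IsE2Kernel p) {k : ℕ} (hk : 1 ≤ k) :
    (p (Sum.inl (bY k), 0)).comap Sum.inl =
      (1 - (1 / 2 : ℝ≥0∞) ^ (k - 1)) • Measure.dirac (bY k) := by
  obtain ⟨h1, h2⟩ := hp.2.2.2.1 k hk
  have h : (1 / 2 : ℝ≥0∞) ^ (k - 1) ≤ 1 := pow_le_one' (by simp) _
  rw [comap_inl_eq_sum_of_sum_eq_one _ {bY k}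
    (by rw [Finset.sum_singleton, h1, h2, tsub_add_cancel_of_le h]), Finset.sum_singleton, h1]

lemma IsE2Kernel.comap_step (hp : IsE2Kernel p) (k : ℕ) :
    (p (Sum.inl (bY k), 1)).comap Sum.inl = (1 / 2 : ℝ≥0∞) • Measure.dirac (bY (k + 1)) := by
  obtain ⟨h1, h2⟩ := hp.2.2.2.2.1 k
  rw [comap_inl_eq_sum_of_sum_eq_one _ {bY (k + 1)}
    (by rw [Finset.sum_singleton, h1, h2, ENNReal.add_halves]), Finset.sum_singleton, h2]

lemma IsE2Kernel.comap_branch (hp : IsE2Kernel p) (k : ℕ) :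
    (p (Sum.inl (bY k), 2)).comap Sum.inl =
      (1 / 2 : ℝ≥0∞) • Measure.dirac (bY (k + 1)) + (1 / 4 : ℝ≥0∞) • Measure.dirac oneY := by
  obtain ⟨h1, h2, h3⟩ := hp.2.2.2.2.2 k
  have hs : (1 / 2 : ℝ≥0∞) + 1 / 4 + 1 / 4 = 1 := by
    rw [← ENNReal.toReal_eq_one_iff, ENNReal.toReal_add (by simp) (by simp),
      ENNReal.toReal_add (by simp) (by simp)]
    norm_num
  rw [comap_inl_eq_sum_of_sum_eq_one _ {bY (k + 1), oneY}
    (by rw [Finset.sum_pair (bY_ne_oneY _), h1, h2, h3, hs]),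
    Finset.sum_pair (bY_ne_oneY _), h2, h3]

variable {π : Strategy X2 A2}

lemma IsE2Kernel.comap_stateLaw_succ (hp : IsE2Kernel p) {ψ : X2 → A2}
    (hπ : IsStationaryWith π ψ) (t : ℕ) :
    (stateLaw p π x02 (t + 1)).comap Sum.inl =
      ((stateLaw p π x02 t).comap Sum.inl).bind fun y : Y2 =>
        (p (Sum.inl y, ψ (Sum.inl y))).comap Sum.inl := by
  rw [stateLaw_succ p hπ, comap_inl_bind _ _ (hp.comap_cemetery _)]

lemma IsE2Kernel.comap_stateLaw_psiN_of_le (hp : IsE2Kernel p) {n : ℕ}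
    (hπ : IsStationaryWith π (psiN n)) {t : ℕ} (ht : t ≤ n) :
    (stateLaw p π x02 t).comap Sum.inl = (1 / 2 : ℝ≥0∞) ^ t • Measure.dirac (bY t) := by
  induction t with
  | zero => rw [comap_stateLaw_zero, pow_zero, one_smul]
  | succ t ih =>
    rw [hp.comap_stateLaw_succ hπ, ih (by omega), Measure.bind_smul,
      Measure.dirac_bind .of_discrete, psiN_bY_of_lt (by omega), hp.comap_step, smul_smul, pow_succ]

lemma IsE2Kernel.comap_stateLaw_psiN_add (hp : IsE2Kernel p) {n : ℕ} (hn : 1 ≤ n)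
    (hπ : IsStationaryWith π (psiN n)) (s : ℕ) :
    (stateLaw p π x02 (s + n)).comap Sum.inl =
      ((1 / 2 : ℝ≥0∞) ^ n * (1 - (1 / 2 : ℝ≥0∞) ^ (n - 1)) ^ s) • Measure.dirac (bY n) := by
  induction s with
  | zero => rw [zero_add, hp.comap_stateLaw_psiN_of_le hπ le_rfl, pow_zero, mul_one]
  | succ s ih =>
    rw [Nat.add_right_comm, hp.comap_stateLaw_succ hπ, ih, Measure.bind_smul,
      Measure.dirac_bind .of_discrete, psiN_bY_self, hp.comap_stay hn, smul_smul, pow_succ,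
      mul_assoc]

lemma IsE2Kernel.comap_stateLaw_psiInf_succ (hp : IsE2Kernel p)
    (hπ : IsStationaryWith π psiInf) (t : ℕ) :
    (stateLaw p π x02 (t + 1)).comap Sum.inl =
      (1 / 2 : ℝ≥0∞) ^ (t + 1) • Measure.dirac (bY (t + 1)) +
        ((1 / 2 : ℝ≥0∞) ^ t * (1 / 4)) • Measure.dirac oneY := by
  have hadd (μ ν : Measure Y2) (f : Y2 → Measure Y2) :
      (μ + ν).bind f = μ.bind f + ν.bind f := by
    ext s hs
    simp [Measure.bind_apply hs .of_discrete]
  induction t with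
  | zero =>
    rw [hp.comap_stateLaw_succ hπ, comap_stateLaw_zero, Measure.dirac_bind .of_discrete]
    simpa [psiInf] using hp.comap_branch 0
  | succ t ih =>
    rw [hp.comap_stateLaw_succ hπ, ih, hadd, Measure.bind_smul, Measure.bind_smul,
      Measure.dirac_bind .of_discrete, Measure.dirac_bind .of_discrete, hp.comap_oneY, smul_zero,
      add_zero, psiInf, hp.comap_branch, smul_add, smul_smul, smul_smul, pow_succ _ (t + 1)]

/-- The marginal on `Y` of the occupation measure of `ψ^n`. -/
def psiNMarginal (n : ℕ) : Measure Y2 :=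
  ∑ k ∈ Finset.range n, (1 / 2 : ℝ≥0∞) ^ k • Measure.dirac (bY k) +
    (1 / 2 : ℝ≥0∞) • Measure.dirac (bY n)

/-- The marginal on `Y` of the occupation measure of `ψ ≡ 3`. -/
def psiInfMarginal : Measure Y2 :=
  Measure.sum (fun k => (1 / 2 : ℝ≥0∞) ^ k • Measure.dirac (bY k)) +
    (1 / 2 : ℝ≥0∞) • Measure.dirac oneY

lemma tsum_half_pow : ∑' k : ℕ, (1 / 2 : ℝ≥0∞) ^ k = 2 := by
  simp [ENNReal.tsum_geometric]

lemma IsE2Kernel.map_fst_occupation_psiN (hp : IsE2Kernel p) {n : ℕ} (hn : 1 ≤ n)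
    (hπ : IsStationaryWith π (psiN n)) :
    (occupation p π x02).map Prod.fst = psiNMarginal n := by
  have hr : (1 / 2 : ℝ≥0∞) ^ n * (1 - (1 - (1 / 2 : ℝ≥0∞) ^ (n - 1)))⁻¹ = 1 / 2 := by
    obtain ⟨m, rfl⟩ := Nat.exists_eq_add_of_le' hn
    have h : (1 / 2 : ℝ≥0∞) ^ m ≤ 1 := pow_le_one' (by simp) _
    rw [Nat.add_sub_cancel, ENNReal.sub_sub_cancel ENNReal.one_ne_top h, pow_succ, mul_right_comm,
      ENNReal.mul_inv_cancel (by simp) (by simp), one_mul]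
  rw [occupation_map_fst p hπ]
  ext s hs
  rw [Measure.sum_apply _ hs, ← Summable.sum_add_tsum_nat_add' (k := n) ENNReal.summable, psiNMarginal,
    Measure.add_apply, Measure.finsetSum_apply]
  congr 1
  · refine Finset.sum_congr rfl fun t ht => ?_
    rw [hp.comap_stateLaw_psiN_of_le hπ (Finset.mem_range.1 ht).le]
  · simp_rw [hp.comap_stateLaw_psiN_add hn hπ, Measure.smul_apply, smul_eq_mul]
    rw [ENNReal.tsum_mul_right, ENNReal.tsum_mul_left, ENNReal.tsum_geometric, hr]

lemma IsE2Kernel.map_fst_occupation_psiInf (hp : IsE2Kernel p)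
    (hπ : IsStationaryWith π psiInf) :
    (occupation p π x02).map Prod.fst = psiInfMarginal := by
  have hr : (2 : ℝ≥0∞) * (1 / 4) = 1 / 2 := by
    rw [← ENNReal.toReal_eq_toReal_iff' (by finiteness) (by simp)]
    norm_num
  rw [occupation_map_fst p hπ]
  ext s hs
  rw [Measure.sum_apply _ hs, tsum_eq_zero_add' ENNReal.summable, comap_stateLaw_zero,
    psiInfMarginal, Measure.add_apply, Measure.sum_apply _ hs,
    tsum_eq_zero_add'
      (f := fun k => ((1 / 2 : ℝ≥0∞) ^ k • Measure.dirac (bY k)) s) ENNReal.summable, pow_zero, one_smul, add_assoc]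
  simp_rw [hp.comap_stateLaw_psiInf_succ hπ, Measure.add_apply]
  rw [ENNReal.tsum_add]
  congr 2
  simp_rw [Measure.smul_apply, smul_eq_mul]
  rw [ENNReal.tsum_mul_right, ENNReal.tsum_mul_right, tsum_half_pow, hr]

end Transitions

instance (n : ℕ) : IsFiniteMeasure (psiNMarginal n) where
  measure_univ_lt_top := by
    simp only [psiNMarginal, Measure.add_apply, Measure.finsetSum_apply, Measure.smul_apply,
      measure_univ, smul_eq_mul, mul_one]
    exact ENNReal.add_lt_top.2 ⟨ENNReal.sum_lt_top.2 fun _ _ => by finiteness, by finiteness⟩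

instance : IsFiniteMeasure psiInfMarginal where
  measure_univ_lt_top := by
    simp only [psiInfMarginal, Measure.add_apply, Measure.sum_apply _ MeasurableSet.univ,
      Measure.smul_apply, measure_univ, smul_eq_mul, mul_one, tsum_half_pow]
    finiteness

/-- `psiNMarginal` as a finite measure. -/
def psiNFinite (n : ℕ) : FiniteMeasure Y2 := ⟨psiNMarginal n, inferInstance⟩

/-- `psiInfMarginal` as a finite measure. -/
def psiInfFinite : FiniteMeasure Y2 := ⟨psiInfMarginal, inferInstance⟩

lemma integrable_of_abs_le {α : Type*} [MeasurableSpace α] (μ : Measure α) [IsFiniteMeasure μ]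
    {f : α → ℝ} (hf : Measurable f) (hC : ∃ C, ∀ z, |f z| ≤ C) : Integrable f μ :=
  let ⟨C, hC⟩ := hC
  .of_bound hf.aestronglyMeasurable C (.of_forall hC)

lemma integral_psiNMarginal (n : ℕ) {f : Y2 → ℝ} (hf : Measurable f)
    (hC : ∃ C, ∀ z, |f z| ≤ C) :
    ∫ y, f y ∂psiNMarginal n = ∑ k ∈ Finset.range n, (1 / 2) ^ k * f (bY k) + 1 / 2 * f (bY n) := by
  have h := integrable_of_abs_le (psiNMarginal n) hf hC
  rw [psiNMarginal, integrable_add_measure, integrable_finsetSum_measure] at h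
  rw [psiNMarginal, integral_add_measure (integrable_finsetSum_measure.2 h.1) h.2,
    integral_finsetSum_measure h.1]
  simp

lemma hasSum_integral_psiInfMarginal {f : Y2 → ℝ} (hf : Measurable f)
    (hC : ∃ C, ∀ z, |f z| ≤ C) :
    HasSum (fun k => (1 / 2) ^ k * f (bY k)) (∫ y, f y ∂psiInfMarginal - 1 / 2 * f oneY) := by
  have h := integrable_of_abs_le psiInfMarginal hf hC
  rw [psiInfMarginal, integrable_add_measure] at h
  rw [psiInfMarginal, integral_add_measure h.1 h.2]
  simpa using hasSum_integral_measure h.1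

lemma setOf_marginals_eq {p : Kernel (X2 × A2) X2} [IsMarkovKernel p] (hp : IsE2Kernel p) :
    {ν : FiniteMeasure Y2 | ∃ π ∈ Lambda2,
      (ν : Measure Y2) = (occupation p π x02).map Prod.fst} =
    insert psiInfFinite
      (Set.range fun n : ℕ => psiNFinite (n + 3)) := by
  ext ν
  constructor
  · rintro ⟨π, ⟨n, hn, hπ⟩ | hπ, hν⟩
    · obtain ⟨m, rfl⟩ := Nat.exists_eq_add_of_le' hn
      exact Or.inr ⟨m, Subtype.ext ((hp.map_fst_occupation_psiN (by omega) hπ).symm.trans hν.symm)⟩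
    · exact Or.inl (Subtype.ext (hν.trans (hp.map_fst_occupation_psiInf hπ)))
  · rintro (rfl | ⟨n, rfl⟩)
    · have hπ := isStationaryWith_stationaryStrategy psiInf
      exact ⟨_, Or.inr hπ, (hp.map_fst_occupation_psiInf hπ).symm⟩
    · have hπ := isStationaryWith_stationaryStrategy (psiN (n + 3))
      exact ⟨_, Or.inl ⟨n + 3, by omega, hπ⟩,
        (hp.map_fst_occupation_psiN (by omega) hπ).symm⟩

lemma tendsto_psiNMarginal :
    Tendsto (fun n : ℕ => psiNFinite (n + 3)) atTop
      (@nhds _ (wTop Y2) psiInfFinite) := by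
  unfold wTop
  simp only [nhds_iInf, nhds_induced, tendsto_iInf, tendsto_comap_iff]
  intro g hg hC
  change Tendsto (fun n => ∫ y, g y ∂psiNMarginal (n + 3)) atTop (𝓝 (∫ y, g y ∂psiInfMarginal))
  refine (tendsto_add_atTop_iff_nat (f := fun n => ∫ y, g y ∂psiNMarginal n) 3).2 ?_
  simp_rw [integral_psiNMarginal _ hg.measurable hC]
  have h := (hasSum_integral_psiInfMarginal hg.measurable hC).tendsto_sum_nat.add
    (((hg.tendsto _).comp tendsto_bY).const_mul (1 / 2))
  simpa using h

/-- The set `{b_{k+1} : k ≥ n}`, the left neighbourhood of `1` without `1` itself. -/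
def tailY (n : ℕ) : Set Y2 := bY '' Set.Ici n

lemma abs_indicator_one_le {α : Type*} (s : Set α) :
    ∃ C, ∀ z, |s.indicator (fun _ => (1 : ℝ)) z| ≤ C :=
  ⟨1, fun z => by by_cases h : z ∈ s <;> simp [h]⟩

lemma continuous_integral_indicator_tailY (n : ℕ) :
    @Continuous _ _ (sTop Y2) _ fun η : FiniteMeasure Y2 =>
      ∫ y, (tailY n).indicator (fun _ => (1 : ℝ)) y ∂(η : Measure Y2) := by
  rw [continuous_iff_le_induced]
  exact iInf_le_of_le _ (iInf_le_of_le .of_discrete (iInf_le_of_le (abs_indicator_one_le _) le_rfl))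

/-- The s-open set of measures giving mass less than `1/4` to `tailY n`. -/
def smallTail (n : ℕ) : Set (FiniteMeasure Y2) :=
  {η | ∫ y, (tailY n).indicator (fun _ => (1 : ℝ)) y ∂(η : Measure Y2) < 1 / 4}

lemma smallTail_mono : Monotone smallTail := by
  intro m n hmn η hη
  change ∫ y, (tailY m).indicator (fun _ => (1 : ℝ)) y ∂(η : Measure Y2) < 1 / 4 at hη
  change ∫ y, (tailY n).indicator (fun _ => (1 : ℝ)) y ∂(η : Measure Y2) < 1 / 4
  refine lt_of_le_of_lt ?_ hη
  rw [integral_indicator_const _ .of_discrete, integral_indicator_const _ .of_discrete]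
  have : tailY n ⊆ tailY m := Set.image_mono (Set.Ici_subset_Ici.2 hmn)
  simpa only [smul_eq_mul, mul_one] using measureReal_mono this

lemma not_isCompact_sTop :
    ¬ @IsCompact _ (sTop Y2) (insert psiInfFinite
      (Set.range fun n : ℕ => psiNFinite (n + 3))) := by
  let := sTop Y2
  intro hK
  have hb (k n : ℕ) : bY k ∈ tailY n ↔ n ≤ k := by
    simp [tailY, bY_injective.eq_iff]
  have h1 (n : ℕ) : oneY ∉ tailY n := by
    rintro ⟨k, -, hk⟩
    exact bY_ne_oneY k hk
  have hcover : insert psiInfFinite (Set.range fun n : ℕ => psiNFinite (n + 3)) ⊆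
      ⋃ n, smallTail n := by
    rintro _ (rfl | ⟨n, rfl⟩)
    · refine Set.mem_iUnion.2 ⟨4, ?_⟩
      have h := hasSum_integral_psiInfMarginal (f := (tailY 4).indicator fun _ => (1 : ℝ))
        .of_discrete (abs_indicator_one_le _)
      rw [Set.indicator_of_notMem (h1 4), mul_zero, sub_zero, ← hasSum_nat_add_iff' 4] at h
      have h' := (hasSum_geometric_two.mul_right ((1 / 2 : ℝ) ^ 4)).unique
        (by simpa [hb, pow_add, Finset.sum_range_succ] using h)
      change ∫ y, (tailY 4).indicator (fun _ => (1 : ℝ)) y ∂psiInfMarginal < 1 / 4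
      rw [← h']
      norm_num
    · refine Set.mem_iUnion.2 ⟨n + 4, ?_⟩
      change ∫ y, (tailY (n + 4)).indicator (fun _ => (1 : ℝ)) y ∂psiNMarginal (n + 3) < 1 / 4
      rw [integral_psiNMarginal _ .of_discrete (abs_indicator_one_le _),
        Set.indicator_of_notMem (by rw [hb]; omega), Finset.sum_eq_zero]
      · norm_num
      · intro k hk
        have := Finset.mem_range.1 hk
        rw [Set.indicator_of_notMem (by rw [hb]; omega), mul_zero]
  obtain ⟨N, hN⟩ := hK.elim_directed_cover smallTail
    (fun n => isOpen_Iio.preimage (continuous_integral_indicator_tailY n)) hcover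
    (directed_of_isDirected_le smallTail_mono)
  have h : ∫ y, (tailY N).indicator (fun _ => (1 : ℝ)) y ∂psiNMarginal (N + 3) < 1 / 4 :=
    hN (Or.inr ⟨N, rfl⟩)
  rw [integral_psiNMarginal _ .of_discrete (abs_indicator_one_le _),
    Set.indicator_of_mem ((hb _ _).2 (by omega))] at h
  have : 0 ≤ ∑ k ∈ Finset.range (N + 3),
      (1 / 2 : ℝ) ^ k * (tailY N).indicator (fun _ => (1 : ℝ)) (bY k) :=
    Finset.sum_nonneg fun k _ => mul_nonneg (by positivity)
      (Set.indicator_nonneg (fun _ _ => zero_le_one) _)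
  linarith

/-- For the model E2 with initial state `x₀ = b_1 = 1/2` and
`Λ = {ψ^n : n ≥ 3} ∪ {ψ}`, the set `D^Λ_{x₀}|_Y` of marginals on `Y` of the occupation
measures over `Λ` is w-compact in `M(Y)` but not s-compact. -/
theorem stmt15
    (p : Kernel (X2 × A2) X2) [IsMarkovKernel p] (hp : IsE2Kernel p) :
    @IsCompact _ (wTop Y2)
        {ν : FiniteMeasure Y2 | ∃ π ∈ Lambda2,
          (ν : Measure Y2) = (occupation p π x02).map Prod.fst} ∧
      ¬ @IsCompact _ (sTop Y2)
        {ν : FiniteMeasure Y2 | ∃ π ∈ Lambda2,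
          (ν : Measure Y2) = (occupation p π x02).map Prod.fst} := by
  rw [setOf_marginals_eq hp]
  exact ⟨@Tendsto.isCompact_insert_range _ (wTop Y2) _ _ tendsto_psiNMarginal, not_isCompact_sTop⟩

end
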